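/- Let κ̄ ∈ ℝ with κ̄ ≠ 0, let r₀ > 0, and let r : [0,T] → ℝ be a differentiable function with r(0) = r₀, r(t) > 0 for all t ∈ [0,T], κ̄²·r(t)² ≠ 1 for all t ∈ [0,T], and satisfying the ordinary differential equation r′(t) = (1/(2r(t)))·(1/r(t) − κ̄)·(1/r(t) + κ̄) for all t ∈ [0,T]. Then for every t ∈ [0,T] it holds that κ̄⁴·t + κ̄²·(r(t)² − r₀²) + log((1 − κ̄²·r(t)²)/(1 − κ̄²·r₀²)) = 0. -/

import Mathlib

open Set

/-- A positive solution of the radius ODE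
`r′ = (1/(2r))·(1/r − κ̄)·(1/r + κ̄)` on `[0, T]` with `κ̄ ≠ 0`,
`r(0) = r₀ > 0` and `κ̄²·r(t)² ≠ 1`, satisfies the implicit relation
`κ̄⁴·t + κ̄²·(r(t)² − r₀²) + log((1 − κ̄²·r(t)²)/(1 − κ̄²·r₀²)) = 0`. -/
theorem willmore_circle_implicit_relation (κ : ℝ) (hκ : κ ≠ 0)
    (r₀ : ℝ) (hr₀ : 0 < r₀) (T : ℝ) (r : ℝ → ℝ)
    (hr0 : r 0 = r₀)
    (hpos : ∀ t ∈ Icc (0 : ℝ) T, 0 < r t)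
    (hne : ∀ t ∈ Icc (0 : ℝ) T, κ ^ 2 * r t ^ 2 ≠ 1)
    (hode : ∀ t ∈ Icc (0 : ℝ) T,
      HasDerivWithinAt r
        (1 / (2 * r t) * (1 / r t - κ) * (1 / r t + κ)) (Icc (0 : ℝ) T) t) :
    ∀ t ∈ Icc (0 : ℝ) T,
      κ ^ 4 * t + κ ^ 2 * (r t ^ 2 - r₀ ^ 2)
        + Real.log ((1 - κ ^ 2 * r t ^ 2) / (1 - κ ^ 2 * r₀ ^ 2)) = 0 := by
  intro t₁ ht₁
  have h0 : 1 - κ ^ 2 * r₀ ^ 2 ≠ 0 := by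
    have h := hne 0 ⟨le_rfl, ht₁.1.trans ht₁.2⟩
    rw [hr0] at h
    exact sub_ne_zero.mpr h.symm
  have hderiv : ∀ t ∈ Icc (0 : ℝ) T, HasDerivWithinAt
      (fun t => κ ^ 4 * t + κ ^ 2 * (r t ^ 2 - r₀ ^ 2)
        + Real.log ((1 - κ ^ 2 * r t ^ 2) / (1 - κ ^ 2 * r₀ ^ 2))) 0 (Icc (0 : ℝ) T) t := by
    intro t ht
    have hr : r t ≠ 0 := (hpos t ht).ne'
    have h1 : 1 - κ ^ 2 * r t ^ 2 ≠ 0 := sub_ne_zero.mpr (hne t ht).symm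
    have hsq := (hode t ht).pow 2
    have hlog := (((hsq.const_mul (κ ^ 2)).const_sub 1).div_const (1 - κ ^ 2 * r₀ ^ 2)).log
      (div_ne_zero h1 h0)
    have hsum := (((hasDerivWithinAt_id t (Icc (0 : ℝ) T)).const_mul (κ ^ 4)).add
      ((hsq.sub_const (r₀ ^ 2)).const_mul (κ ^ 2))).add hlog
    refine hsum.congr_deriv ?_
    simp only [Pi.pow_apply]
    field_simp
    ring
  have hconst := constant_of_derivWithin_zero
    (fun s hs => (hderiv s hs).differentiableWithinAt)
    (fun s hs => (hderiv s ⟨hs.1, hs.2.le⟩).derivWithin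
      (uniqueDiffOn_Icc (hs.1.trans_lt hs.2) s ⟨hs.1, hs.2.le⟩)) t₁ ht₁
  simpa [hr0, div_self h0] using hconst
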